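/- Let P be the Pell sequence (P_0 = 0, P_1 = 1, P_n = 2P_{n-1} + P_{n-2}), Q the associated Pell sequence (Q_0 = 1, Q_1 = 1, Q_n = 2Q_{n-1} + Q_{n-2}), and C the Lucas-balancing sequence (C_0 = 1, C_1 = 3, C_n = 6C_{n-1} − C_{n-2}). For every k ≥ 1, the greatest common divisor of the set { Σ_{i=1}^{k} C_{n+i} : n ≥ 0 } of all sums of k consecutive Lucas-balancing numbers equals 2·P_k if k is even, and equals Q_k if k is odd. -/

import Mathlib

/-- The Pell sequence: P₀ = 0, P₁ = 1, Pₙ = 2Pₙ₋₁ + Pₙ₋₂. -/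
def pell : ℕ → ℤ
  | 0 => 0
  | 1 => 1
  | n + 2 => 2 * pell (n + 1) + pell n

/-- The associated Pell sequence: Q₀ = 1, Q₁ = 1, Qₙ = 2Qₙ₋₁ + Qₙ₋₂. -/
def assocPell : ℕ → ℤ
  | 0 => 1
  | 1 => 1
  | n + 2 => 2 * assocPell (n + 1) + assocPell n

/-- The Lucas-balancing sequence: C₀ = 1, C₁ = 3, Cₙ = 6Cₙ₋₁ − Cₙ₋₂. -/
def lucasBalancing : ℕ → ℤ
  | 0 => 1
  | 1 => 3
  | n + 2 => 6 * lucasBalancing (n + 1) - lucasBalancing n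

/-- `d` is the greatest common divisor of the set `{S n : n ≥ 0}`: `d ≥ 1`, `d` divides
every element of the set, and every common divisor of the set divides `d`. -/
def IsSetGCD (S : ℕ → ℤ) (d : ℤ) : Prop :=
  1 ≤ d ∧ (∀ n : ℕ, d ∣ S n) ∧ ∀ e : ℤ, (∀ n : ℕ, e ∣ S n) → e ∣ d

theorem pell_add_two (n : ℕ) : pell (n + 2) = 2 * pell (n + 1) + pell n := rfl

theorem assocPell_add_two (n : ℕ) :
    assocPell (n + 2) = 2 * assocPell (n + 1) + assocPell n := rfl

theorem lucasBalancing_add_two (n : ℕ) :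
    lucasBalancing (n + 2) = 6 * lucasBalancing (n + 1) - lucasBalancing n := rfl

theorem pell_assocPell_succ (n : ℕ) :
    pell (n + 1) = pell n + assocPell n ∧ assocPell (n + 1) = assocPell n + 2 * pell n := by
  induction n with
  | zero => decide
  | succ n ih =>
    obtain ⟨h₁, h₂⟩ := ih
    rw [pell_add_two, assocPell_add_two]
    constructor <;> linarith

theorem pell_succ (n : ℕ) : pell (n + 1) = pell n + assocPell n :=
  (pell_assocPell_succ n).1

theorem assocPell_succ (n : ℕ) : assocPell (n + 1) = assocPell n + 2 * pell n :=
  (pell_assocPell_succ n).2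

theorem pell_assocPell_add (m n : ℕ) :
    pell (m + n) = pell m * assocPell n + assocPell m * pell n ∧
      assocPell (m + n) = assocPell m * assocPell n + 2 * pell m * pell n := by
  induction n with
  | zero => simp [pell, assocPell]
  | succ n ih =>
    obtain ⟨h₁, h₂⟩ := ih
    rw [← add_assoc, pell_succ, assocPell_succ, pell_succ, assocPell_succ, h₁, h₂]
    constructor <;> ring

theorem pell_add (m n : ℕ) :
    pell (m + n) = pell m * assocPell n + assocPell m * pell n :=
  (pell_assocPell_add m n).1

theorem assocPell_add (m n : ℕ) :
    assocPell (m + n) = assocPell m * assocPell n + 2 * pell m * pell n :=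
  (pell_assocPell_add m n).2

theorem assocPell_sq_sub (n : ℕ) : assocPell n ^ 2 - 2 * pell n ^ 2 = (-1) ^ n := by
  induction n with
  | zero => decide
  | succ n ih =>
    rw [pell_succ, assocPell_succ, pow_succ (-1 : ℤ), ← ih]
    ring

theorem odd_assocPell (n : ℕ) : Odd (assocPell n) := by
  induction n with
  | zero => exact odd_one
  | succ n ih =>
    rw [assocPell_succ]
    exact ih.add_even (even_two_mul _)

theorem odd_pell_of_odd {n : ℕ} (hn : Odd n) : Odd (pell n) := by
  obtain ⟨m, rfl⟩ := hn
  induction m with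
  | zero => exact odd_one
  | succ m ih =>
    rw [show 2 * (m + 1) + 1 = 2 * m + 1 + 2 by ring, pell_add_two]
    exact (even_two_mul _).add_odd ih

theorem assocPell_pos_pell_nonneg (n : ℕ) : 0 < assocPell n ∧ 0 ≤ pell n := by
  induction n with
  | zero => decide
  | succ n ih =>
    rw [pell_succ, assocPell_succ]
    constructor <;> linarith [ih.1, ih.2]

theorem assocPell_pos (n : ℕ) : 0 < assocPell n :=
  (assocPell_pos_pell_nonneg n).1

theorem pell_pos {n : ℕ} (hn : 1 ≤ n) : 0 < pell n := by
  obtain ⟨m, rfl⟩ := Nat.exists_eq_add_of_le' hn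
  rw [pell_succ]
  linarith [assocPell_pos m, (assocPell_pos_pell_nonneg m).2]

theorem isCoprime_pell_assocPell (n : ℕ) : IsCoprime (pell n) (assocPell n) := by
  refine ⟨(-1) ^ n * (-2 * pell n), (-1) ^ n * assocPell n, ?_⟩
  calc (-1) ^ n * (-2 * pell n) * pell n + (-1) ^ n * assocPell n * assocPell n
      = (-1) ^ n * (assocPell n ^ 2 - 2 * pell n ^ 2) := by ring
    _ = 1 := by rw [assocPell_sq_sub, ← mul_pow]; simp

theorem isCoprime_pell_add_two {n : ℕ} (hn : Odd n) :
    IsCoprime (pell n) (pell (n + 2)) := by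
  have h2 : IsCoprime (pell n) 2 := Int.isCoprime_two_right.2 (odd_pell_of_odd hn)
  have h := (h2.mul_right (isCoprime_pell_assocPell n)).add_mul_left_right 3
  rwa [show pell (n + 2) = 2 * assocPell n + pell n * 3 by
    rw [pell_add_two, pell_succ]; ring]

theorem isCoprime_assocPell_add_two (n : ℕ) :
    IsCoprime (assocPell n) (assocPell (n + 2)) := by
  have h2 : IsCoprime (assocPell n) 2 := Int.isCoprime_two_right.2 (odd_assocPell n)
  have h := (h2.mul_right (h2.mul_right
    (isCoprime_pell_assocPell n).symm)).add_mul_left_right 3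
  rwa [show assocPell (n + 2) = 2 * (2 * pell n) + assocPell n * 3 by
    rw [assocPell_add_two, assocPell_succ]; ring]

theorem lucasBalancing_eq_assocPell (n : ℕ) : lucasBalancing n = assocPell (2 * n) := by
  induction n using Nat.twoStepInduction with
  | zero => rfl
  | one => rfl
  | more n ih₀ ih₁ =>
    rw [lucasBalancing_add_two, ih₀, ih₁, show 2 * (n + 2) = 2 * n + 2 + 2 by ring,
      show 2 * (n + 1) = 2 * n + 2 by ring]
    simp only [assocPell_succ, pell_succ]
    ring

theorem two_mul_sum_lucasBalancing (n k : ℕ) :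
    2 * ∑ i ∈ Finset.Icc 1 k, lucasBalancing (n + i) =
      assocPell (2 * n + 1 + k + k) - assocPell (2 * n + 1) := by
  induction k with
  | zero => simp
  | succ k ih =>
    rw [Finset.sum_Icc_succ_top (by lia), mul_add, ih, lucasBalancing_eq_assocPell,
      show 2 * n + 1 + (k + 1) + (k + 1) = 2 * n + 1 + k + k + 2 by ring,
      show 2 * (n + (k + 1)) = 2 * n + 1 + k + k + 1 by ring, assocPell_add_two]
    ring

theorem assocPell_add_mul_sub (m k : ℕ) :
    assocPell (m + k) * assocPell k - 2 * pell (m + k) * pell k =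
      (-1) ^ k * assocPell m := by
  rw [assocPell_add, pell_add, ← assocPell_sq_sub]
  ring

theorem sum_lucasBalancing_of_even (n : ℕ) {k : ℕ} (hk : Even k) :
    ∑ i ∈ Finset.Icc 1 k, lucasBalancing (n + i) = 2 * pell k * pell (2 * n + 1 + k) := by
  have h₁ := two_mul_sum_lucasBalancing n k
  have h₂ := assocPell_add_mul_sub (2 * n + 1) k
  rw [assocPell_add _ k] at h₁
  rw [hk.neg_one_pow] at h₂
  linarith

theorem sum_lucasBalancing_of_odd (n : ℕ) {k : ℕ} (hk : Odd k) :
    ∑ i ∈ Finset.Icc 1 k, lucasBalancing (n + i) =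
      assocPell k * assocPell (2 * n + 1 + k) := by
  have h₁ := two_mul_sum_lucasBalancing n k
  have h₂ := assocPell_add_mul_sub (2 * n + 1) k
  rw [assocPell_add _ k] at h₁
  rw [hk.neg_one_pow] at h₂
  linarith

theorem isSetGCD_of_eq_mul {S T : ℕ → ℤ} {d : ℤ} (hd : 1 ≤ d) (hS : ∀ n, S n = d * T n)
    (hT : IsCoprime (T 0) (T 1)) : IsSetGCD S d := by
  refine ⟨hd, fun n => ⟨T n, hS n⟩, fun e he => ?_⟩
  obtain ⟨u, v, huv⟩ := hT
  have h : d = u * S 0 + v * S 1 := by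
    rw [hS, hS]
    linear_combination -d * huv
  rw [h]
  exact dvd_add ((he 0).mul_left u) ((he 1).mul_left v)

theorem gcd_sums_lucasBalancing (k : ℕ) (hk : 1 ≤ k) :
    (Even k →
      IsSetGCD (fun n => ∑ i ∈ Finset.Icc 1 k, lucasBalancing (n + i)) (2 * pell k)) ∧
    (Odd k →
      IsSetGCD (fun n => ∑ i ∈ Finset.Icc 1 k, lucasBalancing (n + i)) (assocPell k)) := by
  refine ⟨fun h => ?_, fun h => ?_⟩
  · refine isSetGCD_of_eq_mul (T := fun n => pell (2 * n + 1 + k))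
      (by linarith [pell_pos hk]) (fun n => sum_lucasBalancing_of_even n h) ?_
    convert isCoprime_pell_add_two (h.one_add) using 2
    all_goals ring_nf
  · refine isSetGCD_of_eq_mul (T := fun n => assocPell (2 * n + 1 + k))
      (assocPell_pos k) (fun n => sum_lucasBalancing_of_odd n h) ?_
    convert isCoprime_assocPell_add_two (1 + k) using 2
    all_goals ring_nf
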